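/- Let G be a finitely generated abelian group and let P = ⟨A | R⟩ be any finite presentation of G. Then (n², n) is an (Area, FL)-pair for P: there exists λ > 0 such that every null-homotopic word w admits a null-P-sequence S with Area(S) ≤ λ·ℓ(w)² and FL(S) ≤ λ·ℓ(w). -/

import Mathlib

/-- A word over the alphabet `A`: a list of letters `(a, b)`, where the boolean `b`
records whether the letter is the generator `a` (when `true`) or its formal
inverse `a⁻¹` (when `false`). -/
abbrev Word (A : Type) := List (A × Bool)

/-- The formal inverse of a word. -/
def wordInv {A : Type} (w : Word A) : Word A := (w.map (fun p => (p.1, !p.2))).reverse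

/-- `IsCyclicConj v w` : the word `v` is a cyclic conjugate of the word `w`. -/
def IsCyclicConj {A : Type} (v w : Word A) : Prop := ∃ p q, w = p ++ q ∧ v = q ++ p

/-- A free reduction (deleting a subword `a a⁻¹`, `a` a generator or an inverse of a
generator) or a free expansion (inserting such a subword). -/
def FreeStep {A : Type} (w w' : Word A) : Prop :=
  (∃ (α β : Word A) (x : A × Bool), w = α ++ [x, (x.1, !x.2)] ++ β ∧ w' = α ++ β) ∨
  (∃ (α β : Word A) (x : A × Bool), w = α ++ β ∧ w' = α ++ [x, (x.1, !x.2)] ++ β)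

/-- An application of a relator from `R`: replace `w = αuβ` by `w' = αvβ` where
`u v⁻¹` is a cyclic conjugate of an element of `R` or of the inverse of an element
of `R`. -/
def RelStep {A : Type} (R : Set (Word A)) (w w' : Word A) : Prop :=
  ∃ (α u v β : Word A), w = α ++ u ++ β ∧ w' = α ++ v ++ β ∧
    ∃ r ∈ R, IsCyclicConj (u ++ wordInv v) r ∨ IsCyclicConj (u ++ wordInv v) (wordInv r)

/-- A `P`-sequence for the presentation with relator set `R` : a finite sequence of
words `seq 0, seq 1, …, seq len`, each obtained from the previous one by a free
reduction, a free expansion, or an application of a relator.  The field `isRel`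
records which steps are applications of relators. -/
structure PSeq {A : Type} (R : Set (Word A)) where
  len : ℕ
  seq : Fin (len + 1) → Word A
  isRel : Fin len → Bool
  step : ∀ i : Fin len,
    if isRel i then RelStep R (seq i.castSucc) (seq i.succ)
    else FreeStep (seq i.castSucc) (seq i.succ)

/-- The area of a `P`-sequence: the number of application-of-a-relator moves. -/
def PSeq.area {A : Type} {R : Set (Word A)} (S : PSeq R) : ℕ :=
  (Finset.univ.filter (fun i => S.isRel i = true)).card

/-- The filling length of a `P`-sequence: the maximum of the lengths of its words. -/
def PSeq.fl {A : Type} {R : Set (Word A)} (S : PSeq R) : ℕ :=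
  Finset.univ.sup (fun i => (S.seq i).length)

/-- The height of a `P`-sequence: its number of moves. -/
def PSeq.height {A : Type} {R : Set (Word A)} (S : PSeq R) : ℕ := S.len

/-- `S` is a null-`P`-sequence for the word `w`: it starts at `w` and ends at the
empty word. -/
def IsNullSeq {A : Type} {R : Set (Word A)} (S : PSeq R) (w : Word A) : Prop :=
  S.seq 0 = w ∧ S.seq (Fin.last S.len) = []

section Rewriting

variable {A : Type} {R : Set (Word A)}

theorem wordInv_eq_invRev (w : Word A) : wordInv w = FreeGroup.invRev w := rfl

theorem IsCyclicConj.wordInv {v w : Word A} (h : IsCyclicConj v w) :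
    IsCyclicConj (wordInv v) (wordInv w) := by
  obtain ⟨p, q, rfl, rfl⟩ := h
  exact ⟨_, _, FreeGroup.invRev_append, FreeGroup.invRev_append⟩

theorem FreeStep.symm {w w' : Word A} (h : FreeStep w w') : FreeStep w' w := by
  rcases h with ⟨α, β, x, h, h'⟩ | ⟨α, β, x, h, h'⟩
  · exact Or.inr ⟨α, β, x, h', h⟩
  · exact Or.inl ⟨α, β, x, h', h⟩

theorem RelStep.symm {w w' : Word A} (h : RelStep R w w') : RelStep R w' w := by
  obtain ⟨α, u, v, β, h, h', r, hr, hc⟩ := h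
  refine ⟨α, v, u, β, h', h, r, hr, ?_⟩
  have key : wordInv (u ++ wordInv v) = v ++ wordInv u := by
    simp only [wordInv_eq_invRev, FreeGroup.invRev_append, FreeGroup.invRev_invRev]
  rcases hc with hc | hc
  · exact Or.inr (key ▸ hc.wordInv)
  · refine Or.inl ?_
    have h := hc.wordInv
    rwa [key, wordInv_eq_invRev (wordInv r), wordInv_eq_invRev r, FreeGroup.invRev_invRev] at h

theorem FreeStep.context {w w' : Word A} (h : FreeStep w w') (γ δ : Word A) :
    FreeStep (γ ++ w ++ δ) (γ ++ w' ++ δ) := by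
  rcases h with ⟨α, β, x, rfl, rfl⟩ | ⟨α, β, x, rfl, rfl⟩
  · exact Or.inl ⟨γ ++ α, β ++ δ, x, by simp, by simp⟩
  · exact Or.inr ⟨γ ++ α, β ++ δ, x, by simp, by simp⟩

theorem RelStep.context {w w' : Word A} (h : RelStep R w w') (γ δ : Word A) :
    RelStep R (γ ++ w ++ δ) (γ ++ w' ++ δ) := by
  obtain ⟨α, u, v, β, rfl, rfl, hr⟩ := h
  exact ⟨γ ++ α, u, v, β ++ δ, by simp, by simp, hr⟩

/-- Words that are joined by some `P`-sequence. -/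
def Homotopic (R : Set (Word A)) : Word A → Word A → Prop :=
  Relation.ReflTransGen fun w w' => FreeStep w w' ∨ RelStep R w w'

theorem Homotopic.symm {w w' : Word A} (h : Homotopic R w w') : Homotopic R w' w := by
  induction h with
  | refl => exact .refl
  | tail _ h ih => exact .head (h.imp FreeStep.symm RelStep.symm) ih

theorem Homotopic.trans {w w' w'' : Word A} (h : Homotopic R w w')
    (h' : Homotopic R w' w'') : Homotopic R w w'' :=
  Relation.ReflTransGen.trans h h'

theorem Homotopic.context {w w' : Word A} (h : Homotopic R w w') (γ δ : Word A) :
    Homotopic R (γ ++ w ++ δ) (γ ++ w' ++ δ) :=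
  Relation.ReflTransGen.lift (fun v => γ ++ v ++ δ)
    (fun _ _ h => h.imp (·.context γ δ) (·.context γ δ)) _ _ h

theorem Homotopic.of_mk_eq {w w' : Word A} (h : FreeGroup.mk w = FreeGroup.mk w') :
    Homotopic R w w' := by
  replace h := Quot.eqvGen_exact h
  induction h with
  | rel _ _ h =>
    obtain @⟨α, β, x, b⟩ := h
    exact .single (Or.inl (Or.inl ⟨α, β, (x, b), by simp, rfl⟩))
  | refl => exact .refl
  | symm _ _ _ ih => exact ih.symm
  | trans _ _ _ _ _ ih ih' => exact ih.trans ih'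

/-- The elements of the free group represented by words that are homotopic to the
empty word. -/
def nullHomotopicSubgroup (R : Set (Word A)) : Subgroup (FreeGroup A) where
  carrier := {g | ∃ w, FreeGroup.mk w = g ∧ Homotopic R w []}
  one_mem' := ⟨[], rfl, .refl⟩
  mul_mem' := by
    rintro _ _ ⟨v, rfl, hv⟩ ⟨w, rfl, hw⟩
    refine ⟨v ++ w, FreeGroup.mul_mk.symm, ?_⟩
    have h : Homotopic R (v ++ w) w := by simpa using hv.context [] w
    exact h.trans hw
  inv_mem' := by
    rintro _ ⟨w, rfl, hw⟩
    refine ⟨FreeGroup.invRev w, FreeGroup.inv_mk.symm, ?_⟩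
    have h : Homotopic R (FreeGroup.invRev w ++ w) (FreeGroup.invRev w) := by
      simpa using hw.context (FreeGroup.invRev w) []
    refine h.symm.trans (.of_mk_eq ?_)
    rw [← FreeGroup.mul_mk, ← FreeGroup.inv_mk, inv_mul_cancel, FreeGroup.one_eq_mk]

instance nullHomotopicSubgroup_normal : (nullHomotopicSubgroup R).Normal where
  conj_mem := by
    rintro _ ⟨w, rfl, hw⟩ g
    induction g using Quot.inductionOn with | _ v => ?_
    refine ⟨v ++ w ++ FreeGroup.invRev v, ?_, (hw.context v _).trans (.of_mk_eq ?_)⟩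
    · rw [← FreeGroup.mul_mk, ← FreeGroup.mul_mk, ← FreeGroup.inv_mk]; rfl
    · rw [List.append_nil, ← FreeGroup.mul_mk, ← FreeGroup.inv_mk, mul_inv_cancel,
        FreeGroup.one_eq_mk]

theorem Homotopic.of_mem_normalClosure {w : Word A}
    (h : FreeGroup.mk w ∈ Subgroup.normalClosure (FreeGroup.mk '' R)) :
    Homotopic R w [] := by
  have hle : Subgroup.normalClosure (FreeGroup.mk '' R) ≤ nullHomotopicSubgroup R := by
    refine Subgroup.normalClosure_le_normal ?_
    rintro _ ⟨r, hr, rfl⟩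
    exact ⟨r, rfl, .single (Or.inr ⟨[], r, [], [], by simp, rfl, r, hr,
      Or.inl ⟨[], r, by simp, by simp [wordInv]⟩⟩)⟩
  obtain ⟨w', h, h'⟩ := hle h
  exact (of_mk_eq h.symm).trans h'

theorem Homotopic.of_mul_inv_mem_normalClosure {w w' : Word A}
    (h : FreeGroup.mk w * (FreeGroup.mk w')⁻¹ ∈
      Subgroup.normalClosure (FreeGroup.mk '' R)) :
    Homotopic R w w' := by
  rw [FreeGroup.inv_mk, FreeGroup.mul_mk] at h
  have h := (of_mem_normalClosure h).context [] w'
  refine Homotopic.trans (.of_mk_eq ?_) h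
  simp [← FreeGroup.mul_mk, ← FreeGroup.inv_mk]

/-- `Derives R N k w w'`: some `P`-sequence from `w` to `w'` has filling length at most
`N` and area at most `k`. -/
inductive Derives (R : Set (Word A)) (N : ℕ) : ℕ → Word A → Word A → Prop
  | refl {k : ℕ} {w : Word A} : w.length ≤ N → Derives R N k w w
  | free {k : ℕ} {w w' w'' : Word A} :
      w.length ≤ N → FreeStep w w' → Derives R N k w' w'' → Derives R N k w w''
  | relator {k : ℕ} {w w' w'' : Word A} :
      w.length ≤ N → RelStep R w w' → Derives R N k w' w'' → Derives R N (k + 1) w w''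

namespace Derives

theorem mono {N M k l : ℕ} {w w' : Word A} (h : Derives R N k w w') (hN : N ≤ M)
    (hk : k ≤ l) : Derives R M l w w' := by
  induction h generalizing l with
  | refl h => exact .refl (h.trans hN)
  | free h hs _ ih => exact .free (h.trans hN) hs (ih hk)
  | relator h hs _ ih =>
    obtain ⟨l, rfl⟩ := Nat.exists_eq_add_of_le' (Nat.one_le_of_lt hk)
    exact .relator (h.trans hN) hs (ih (by omega))

theorem trans {N k l : ℕ} {w w' w'' : Word A} (h : Derives R N k w w')
    (h' : Derives R N l w' w'') : Derives R N (k + l) w w'' := by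
  induction h with
  | refl _ => exact h'.mono le_rfl (Nat.le_add_left _ _)
  | free h hs _ ih => exact .free h hs (ih h')
  | relator h hs _ ih => exact Nat.add_right_comm _ 1 l ▸ .relator h hs (ih h')

theorem context {N k : ℕ} {w w' : Word A} (h : Derives R N k w w') (γ δ : Word A) :
    Derives R (γ.length + N + δ.length) k (γ ++ w ++ δ) (γ ++ w' ++ δ) := by
  induction h with
  | refl h => exact .refl (by simp only [List.length_append]; omega)
  | free h hs _ ih =>
    exact .free (by simp only [List.length_append]; omega) (hs.context γ δ) ih
  | relator h hs _ ih =>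
    exact .relator (by simp only [List.length_append]; omega) (hs.context γ δ) ih

theorem exists_pSeq {N k : ℕ} {w w' : Word A} (h : Derives R N k w w') :
    ∃ S : PSeq R, S.seq 0 = w ∧ S.seq (Fin.last S.len) = w' ∧ S.area ≤ k ∧ S.fl ≤ N := by
  have extend : ∀ (S : PSeq R) (v : Word A) (b : Bool), v.length ≤ N → S.fl ≤ N →
      (if b then RelStep R v (S.seq 0) else FreeStep v (S.seq 0)) →
      ∃ T : PSeq R, T.seq 0 = v ∧ T.seq (Fin.last T.len) = S.seq (Fin.last S.len) ∧
        T.area = (if b then 1 else 0) + S.area ∧ T.fl ≤ N := by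
    intro S v b hv hS hb
    refine ⟨⟨S.len + 1, Fin.cons v S.seq, Fin.cons b S.isRel, ?_⟩, by simp, by simp [← Fin.succ_last], ?_, ?_⟩
    · exact Fin.cases hb S.step
    · simp only [PSeq.area, Finset.card_filter, Fin.sum_univ_succ, Fin.cons_zero,
        Fin.cons_succ]
    · refine Finset.sup_le fun i _ => ?_
      refine Fin.cases hv (fun i => ?_) i
      exact (Finset.le_sup (f := fun i => (S.seq i).length) (Finset.mem_univ i)).trans hS
  induction h with
  | @refl k w h =>
    refine ⟨⟨0, fun _ => w, Fin.elim0, fun i => i.elim0⟩, rfl, rfl, ?_, ?_⟩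
    · simp [PSeq.area]
    · exact Finset.sup_le fun _ _ => h
  | free h hs _ ih =>
    obtain ⟨S, h0, h1, hk, hN⟩ := ih
    obtain ⟨T, h0', h1', hk', hN'⟩ := extend S _ false h hN (by simpa [h0] using hs)
    exact ⟨T, h0', h1'.trans h1, by simp at hk'; omega, hN'⟩
  | relator h hs _ ih =>
    obtain ⟨S, h0, h1, hk, hN⟩ := ih
    obtain ⟨T, h0', h1', hk', hN'⟩ := extend S _ true h hN (by simpa [h0] using hs)
    exact ⟨T, h0', h1'.trans h1, by simp at hk'; omega, hN'⟩

end Derives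

theorem Homotopic.exists_derives {w w' : Word A} (h : Homotopic R w w') :
    ∃ C, Derives R C C w w' := by
  induction h using Relation.ReflTransGen.head_induction_on with
  | refl => exact ⟨_, .refl le_rfl⟩
  | @head v v' h _ ih =>
    obtain ⟨C, hC⟩ := ih
    rcases h with h | h
    · exact ⟨C + v.length, .free (by omega) h (hC.mono (by omega) (by omega))⟩
    · refine ⟨C + v.length + 1, .relator (by omega) h (hC.mono (by omega) (by omega))⟩

theorem exists_uniform_derives {T : Set (Word A × Word A)} (hT : T.Finite)
    (h : ∀ p ∈ T, Homotopic R p.1 p.2) : ∃ C, ∀ p ∈ T, Derives R C C p.1 p.2 := by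
  refine Filter.Eventually.exists (f := Filter.atTop)
    ((Filter.eventually_all_finite hT).2 fun p hp => ?_)
  obtain ⟨C, hC⟩ := (h p hp).exists_derives
  filter_upwards [Filter.eventually_ge_atTop C] with D hD using hC.mono hD hD

theorem derives_move_letter {C : ℕ}
    (hC : ∀ x y : A × Bool, Derives R C C [x, y] [y, x]) (x : A × Bool) (u v : Word A) :
    Derives R (u.length + v.length + 1 + C) (C * u.length)
      (x :: (u ++ v)) (u ++ x :: v) := by
  induction u with
  | nil => exact .refl (by simp)
  | cons y u ih =>
    have h₁ : Derives R ((y :: u).length + v.length + 1 + C) C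
        (x :: y :: (u ++ v)) (y :: x :: (u ++ v)) :=
      ((hC x y).context [] (u ++ v)).mono (by simp; omega) le_rfl
    have h₂ : Derives R ((y :: u).length + v.length + 1 + C) (C * u.length)
        (y :: x :: (u ++ v)) (y :: (u ++ x :: v)) := by
      simpa using (ih.context [y] []).mono
        (show _ ≤ (y :: u).length + v.length + 1 + C by simp; omega) le_rfl
    exact (h₁.trans h₂).mono le_rfl (by simp; ring_nf; rfl)

theorem derives_extract_sublist {C : ℕ}
    (hC : ∀ x y : A × Bool, Derives R C C [x, y] [y, x]) {u w : Word A}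
    (h : u.Sublist w) :
    ∃ w' : Word A, (u ++ w').Perm w ∧
      Derives R (w.length + C) (C * u.length * w.length) w (u ++ w') := by
  induction h with
  | slnil => exact ⟨[], .nil, .refl (by simp)⟩
  | @cons u w x _ ih =>
    obtain ⟨w', hp, hd⟩ := ih
    have hl := hp.length_eq
    rw [List.length_append] at hl
    refine ⟨x :: w', List.perm_middle.trans (hp.cons x), ?_⟩
    have h₁ : Derives R ((x :: w).length + C) (C * u.length * w.length)
        (x :: w) (x :: (u ++ w')) := by
      simpa using (hd.context [x] []).mono
        (show _ ≤ (x :: w).length + C by simp; omega) le_rfl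
    have h₂ := (derives_move_letter hC x u w').mono
      (show _ ≤ (x :: w).length + C by simp; omega) le_rfl
    exact (h₁.trans h₂).mono le_rfl (by simp; ring_nf; rfl)
  | @cons_cons u w x _ ih =>
    obtain ⟨w', hp, hd⟩ := ih
    refine ⟨w', hp.cons x, ?_⟩
    simpa using (hd.context [x] []).mono
      (show _ ≤ (x :: w).length + C by simp; omega)
      (show _ ≤ C * (x :: u).length * (x :: w).length by simp; gcongr <;> omega)

end Rewriting

/-- Every set of nonempty words over a finite alphabet has a finite subset such that each
word of the set contains a word of the subset as a scattered subword. -/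
theorem exists_finite_sublist_basis {α : Type*} [Finite α] (S : Set (List α)) :
    ∃ U ⊆ S, U.Finite ∧ ∀ w ∈ S, ∃ u ∈ U, u.Sublist w := by
  let U : Set (List α) := {u ∈ S | ∀ v ∈ S, v.Sublist u → v = u}
  refine ⟨U, fun _ h => h.1, ?_, ?_⟩
  · have hwqo := (Set.finite_univ (α := α)).partiallyWellOrderedOn
      (r := (· = ·)) |>.partiallyWellOrderedOn_sublistForall₂
    refine IsAntichain.finite_of_partiallyWellOrderedOn
      (r := List.SublistForall₂ (· = ·)) ?_ (hwqo.mono fun _ _ _ _ => Set.mem_univ _)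
    intro u hu v hv huv h
    obtain ⟨l, hl, hs⟩ := List.sublistForall₂_iff.1 h
    rw [List.forall₂_eq_eq_eq] at hl
    subst hl
    exact huv (hv.2 u hu.1 hs)
  · intro w
    induction hn : w.length using Nat.strong_induction_on generalizing w with
    | _ n ih =>
      intro hw
      by_cases hmin : w ∈ U
      · exact ⟨w, hmin, List.Sublist.refl w⟩
      · obtain ⟨v, hv, hvw, hne⟩ : ∃ v ∈ S, v.Sublist w ∧ v ≠ w := by
          by_contra! hcon
          exact hmin ⟨hw, hcon⟩
        have hlt : v.length < w.length :=
          lt_of_le_of_ne hvw.length_le fun h => hne (hvw.eq_of_length h)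
        obtain ⟨u, hu, huv⟩ := ih _ (hn ▸ hlt) v rfl hv
        exact ⟨u, hu, huv.trans hvw⟩

theorem map_mk_eq_of_perm {A G : Type} [CommGroup G] (π : FreeGroup A →* G) {v w : Word A}
    (h : v.Perm w) : π (FreeGroup.mk v) = π (FreeGroup.mk w) := by
  have cons_eq (x : A × Bool) (l : Word A) :
      π (FreeGroup.mk (x :: l)) = π (FreeGroup.mk [x]) * π (FreeGroup.mk l) := by
    rw [← map_mul, FreeGroup.mul_mk, List.singleton_append]
  induction h with
  | nil => rfl
  | cons x _ ih => rw [cons_eq, ih, ← cons_eq]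
  | swap x y l => simp only [cons_eq _ (_ :: _), cons_eq _ l, mul_left_comm]
  | trans _ _ ih ih' => exact ih.trans ih'

/-- **Base case of the induction.**  Let `G` be a finitely generated abelian group
and `⟨A ∣ R⟩` any finite presentation of `G`.  Then `(n², n)` is an
`(Area, FL)`-pair for the presentation: there is `λ > 0` such that every
null-homotopic word `w` admits a null-`P`-sequence `S` with `Area(S) ≤ λ·ℓ(w)²`
and `FL(S) ≤ λ·ℓ(w)`. -/
theorem abelian_area_fl_pair
    {A : Type} [Fintype A] {G : Type} [CommGroup G]
    (R : Finset (Word A)) (π : FreeGroup A →* G)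
    (hsurj : Function.Surjective π)
    (hker : π.ker = Subgroup.normalClosure (FreeGroup.mk '' (R : Set (Word A)))) :
    ∃ lam : ℝ, 0 < lam ∧ ∀ w : Word A, π (FreeGroup.mk w) = 1 →
      ∃ S : PSeq (R : Set (Word A)), IsNullSeq S w ∧
        (S.area : ℝ) ≤ lam * (w.length : ℝ) ^ 2 ∧
        (S.fl : ℝ) ≤ lam * (w.length : ℝ) := by
  have homotopic_of_eq {v w : Word A} (h : π (FreeGroup.mk v) = π (FreeGroup.mk w)) :
      Homotopic (R : Set (Word A)) v w := by
    refine .of_mul_inv_mem_normalClosure ?_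
    rw [← hker, MonoidHom.mem_ker, map_mul, map_inv, h, mul_inv_cancel]
  obtain ⟨U, hUS, hUfin, hU⟩ := exists_finite_sublist_basis
    {w : Word A | w ≠ [] ∧ π (FreeGroup.mk w) = 1}
  obtain ⟨C, hC⟩ := exists_uniform_derives (R := (R : Set (Word A)))
    (Set.finite_range fun p : (A × Bool) × (A × Bool) => ([p.1, p.2], [p.2, p.1])) (by
      rintro _ ⟨⟨x, y⟩, rfl⟩
      exact homotopic_of_eq (map_mk_eq_of_perm π (.swap y x [])))
  replace hC (x y : A × Bool) := hC _ ⟨(x, y), rfl⟩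
  obtain ⟨D, hD⟩ := exists_uniform_derives (R := (R : Set (Word A)))
    (hUfin.image fun u => (u, ([] : Word A))) (by
      rintro _ ⟨u, hu, rfl⟩
      exact homotopic_of_eq ((hUS hu).2.trans (map_one π).symm))
  replace hD {u : Word A} (hu : u ∈ U) := hD _ ⟨u, hu, rfl⟩
  obtain ⟨L, hL⟩ := (hUfin.image List.length).bddAbove
  replace hL {u : Word A} (hu : u ∈ U) : u.length ≤ L := hL ⟨u, hu, rfl⟩
  have fill (n m : ℕ) (hmn : m ≤ n) (w : Word A) (hw : w.length ≤ m)
      (hπ : π (FreeGroup.mk w) = 1) :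
      Derives (R : Set (Word A)) (n + (C + D)) ((C * L + D) * n * m) w [] := by
    induction m generalizing w with
    | zero =>
      rw [List.length_eq_zero_iff.1 (Nat.le_zero.1 hw)]
      exact .refl (Nat.zero_le _)
    | succ m ih =>
      by_cases hne : w = []
      · subst hne
        exact .refl (Nat.zero_le _)
      obtain ⟨u, hu, huw⟩ := hU w ⟨hne, hπ⟩
      obtain ⟨w', hperm, hd⟩ := derives_extract_sublist hC huw
      have hlen := hperm.length_eq
      rw [List.length_append] at hlen
      have hpos := List.length_pos_iff.2 (hUS hu).1
      have hπ' : π (FreeGroup.mk w') = 1 := by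
        have h := map_mk_eq_of_perm π hperm
        rwa [← FreeGroup.mul_mk, map_mul, (hUS hu).2, one_mul, hπ] at h
      have hd₁ := hd.mono (show _ ≤ n + (C + D) by omega)
        (show _ ≤ C * L * n by gcongr; exacts [hL hu, by omega])
      have hd₂ : Derives (R : Set (Word A)) (n + (C + D)) (D * n) (u ++ w') w' :=
        ((hD hu).context [] w').mono (by simp; omega) (Nat.le_mul_of_pos_right D (by omega))
      exact ((hd₁.trans hd₂).trans (ih (by omega) w' (by omega) hπ')).mono le_rfl
        (by ring_nf; rfl)
  refine ⟨((C * L + D : ℕ) : ℝ) + (C + D : ℕ) + 1, by positivity, fun w hw => ?_⟩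
  have hder : Derives (R : Set (Word A)) ((C + D + 1) * w.length)
      ((C * L + D) * w.length * w.length) w [] := by
    by_cases hne : w = []
    · subst hne
      exact .refl (Nat.zero_le _)
    · have hpos := List.length_pos_iff.2 hne
      exact (fill _ _ le_rfl w le_rfl hw).mono (by nlinarith) le_rfl
  obtain ⟨S, h0, h1, harea, hfl⟩ := hder.exists_pSeq
  refine ⟨S, ⟨h0, h1⟩, ?_, ?_⟩
  · refine (Nat.cast_le (α := ℝ).2 harea).trans ?_
    rw [mul_assoc, ← sq, Nat.cast_mul, Nat.cast_pow, add_assoc]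
    gcongr
    exact le_add_of_nonneg_right (by positivity)
  · refine (Nat.cast_le (α := ℝ).2 hfl).trans ?_
    rw [Nat.cast_mul, Nat.cast_succ]
    refine mul_le_mul_of_nonneg_right ?_ (Nat.cast_nonneg _)
    linarith [Nat.cast_nonneg (α := ℝ) (C * L + D)]
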